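/- For every λ ∈ 𝔫*: ξ_λ = (|S̄_λ|/|G|) Σ_{ν ∈ Ξ_λ} θ_ν, and |Ξ_λ| = |G|² / (|L̄_λ|·|S̄_λ|). -/

import Mathlib

open scoped Classical BigOperators ComplexOrder

set_option linter.unusedSectionVars false
set_option linter.unusedVariables false

noncomputable section

namespace IterChar

/-! ### Generic notions for finite groups: inner product, induction, characters -/

/-- The standard inner product `⟨f,h⟩_G = |G|⁻¹ ∑_{x ∈ G} f x * conj (h x)`. -/
def innerG (G : Type) [Group G] (f h : G → ℂ) : ℂ :=
  (Nat.card G : ℂ)⁻¹ * ∑ᶠ x : G, f x * (starRingEnd ℂ) (h x)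

/-- Induction of a function from a subgroup, via the Frobenius formula. -/
def indFun {G : Type} [Group G] (H : Subgroup G) (ψ : ↥H → ℂ) : G → ℂ :=
  fun g => (Nat.card ↥H : ℂ)⁻¹ *
    ∑ᶠ x : G, if h : x * g * x⁻¹ ∈ H then ψ ⟨x * g * x⁻¹, h⟩ else 0

/-- A function `G → ℂ` is a character if it is the trace character of some
finite-dimensional complex representation. -/
def IsCharacter (G : Type) [Group G] (f : G → ℂ) : Prop :=
  ∃ V : FDRep ℂ G, f = FDRep.character V

/-- The set of irreducible characters of `G`: characters of norm one. -/
def Irr (G : Type) [Group G] : Set (G → ℂ) :=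
  {f | IsCharacter G f ∧ innerG G f f = 1}

/-- The set of irreducible constituents of `χ`: irreducible characters with
`⟨χ, ψ⟩_G > 0` (using the complex partial order). -/
def IrrConstituents (G : Type) [Group G] (χ : G → ℂ) : Set (G → ℂ) :=
  {f | f ∈ Irr G ∧ 0 < innerG G χ f}

/-! ### Algebra groups -/

variable {F : Type} [Field F] [Fintype F] {R : Type} [Ring R] [Algebra F R] [Fintype R]

/-- `J` is a nilpotent (non-unital) subalgebra: all products of some fixed length vanish. -/
def IsNil (J : NonUnitalSubalgebra F R) : Prop :=
  ∃ N : ℕ, ∀ l : List R, (∀ x ∈ l, x ∈ J) → l.length = N → l.prod = 0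

/-- The algebra group `G = 1 + J` of a (nilpotent) subalgebra `J ⊆ R`, realized as the
subgroup of units `u` of `R` with `u - 1 ∈ J` (and `u⁻¹ - 1 ∈ J`, which is automatic
when `J` is nilpotent). -/
def algGroup (F : Type) [Field F] [Fintype F] (R : Type) [Ring R] [Algebra F R] [Fintype R]
    (J : NonUnitalSubalgebra F R) : Subgroup Rˣ where
  carrier := {u : Rˣ | ((u : R) - 1 ∈ J) ∧ (((u⁻¹ : Rˣ) : R) - 1 ∈ J)}
  one_mem' := by
    constructor <;> · simp only [Units.val_one, inv_one, sub_self]; exact J.zero_mem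
  mul_mem' := by
    rintro u v ⟨hu1, hu2⟩ ⟨hv1, hv2⟩
    constructor
    · have h : ((u * v : Rˣ) : R) - 1 =
          ((u : R) - 1) * ((v : R) - 1) + ((u : R) - 1) + ((v : R) - 1) := by
        push_cast; noncomm_ring
      rw [h]
      exact add_mem (add_mem (mul_mem hu1 hv1) hu1) hv1
    · have h : (((u * v)⁻¹ : Rˣ) : R) - 1 =
          (((v⁻¹ : Rˣ) : R) - 1) * (((u⁻¹ : Rˣ) : R) - 1) +
            (((v⁻¹ : Rˣ) : R) - 1) + (((u⁻¹ : Rˣ) : R) - 1) := by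
        rw [mul_inv_rev]; push_cast; noncomm_ring
      rw [h]
      exact add_mem (add_mem (mul_mem hv2 hu2) hv2) hu2
  inv_mem' := by
    rintro u ⟨h1, h2⟩
    exact ⟨h2, by simpa using h1⟩

theorem mem_algGroup {J : NonUnitalSubalgebra F R} {u : Rˣ} :
    u ∈ algGroup F R J ↔ ((u : R) - 1 ∈ J) ∧ (((u⁻¹ : Rˣ) : R) - 1 ∈ J) :=
  Iff.rfl

/-- The element `X ∈ J` such that `g = 1 + X`. -/
def gElt {J : NonUnitalSubalgebra F R} (g : ↥(algGroup F R J)) : ↥J :=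
  ⟨((g : Rˣ) : R) - 1, g.2.1⟩

/-- The function `θ_λ(1+X) = θ(λ(X))` on the algebra group `1 + J`. -/
def thetaFn (θ : AddChar F ℂ) (J : NonUnitalSubalgebra F R) (lam : ↥J →ₗ[F] F) :
    ↥(algGroup F R J) → ℂ :=
  fun g => θ (lam (gElt g))

/-- Left multiplication by the group element `g` as a linear endomorphism of `J`. -/
def lmulMap {J : NonUnitalSubalgebra F R} (g : ↥(algGroup F R J)) : ↥J →ₗ[F] ↥J where
  toFun X := ⟨((g : Rˣ) : R) * (X : R), by
    have h : ((g : Rˣ) : R) * (X : R) = (((g : Rˣ) : R) - 1) * (X : R) + (X : R) := by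
      noncomm_ring
    rw [h]; exact add_mem (mul_mem g.2.1 X.2) X.2⟩
  map_add' X Y := by ext; simp [mul_add]
  map_smul' c X := by ext; simp [mul_smul_comm]

/-- Right multiplication by the group element `g` as a linear endomorphism of `J`. -/
def rmulMap {J : NonUnitalSubalgebra F R} (g : ↥(algGroup F R J)) : ↥J →ₗ[F] ↥J where
  toFun X := ⟨(X : R) * ((g : Rˣ) : R), by
    have h : (X : R) * ((g : Rˣ) : R) = (X : R) * (((g : Rˣ) : R) - 1) + (X : R) := by
      noncomm_ring
    rw [h]; exact add_mem (mul_mem X.2 g.2.1) X.2⟩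
  map_add' X Y := by ext; simp [add_mul]
  map_smul' c X := by ext; simp [smul_mul_assoc]

/-- The left action of `G` on the dual space: `(gλ)(X) = λ(g⁻¹ X)`. -/
def leftAct {J : NonUnitalSubalgebra F R} (g : ↥(algGroup F R J)) (lam : ↥J →ₗ[F] F) :
    ↥J →ₗ[F] F :=
  lam.comp (lmulMap g⁻¹)

/-- The right action of `G` on the dual space: `(λg)(X) = λ(X g⁻¹)`. -/
def rightAct {J : NonUnitalSubalgebra F R} (g : ↥(algGroup F R J)) (lam : ↥J →ₗ[F] F) :
    ↥J →ₗ[F] F :=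
  lam.comp (rmulMap g⁻¹)

/-- The coadjoint action of `G` on the dual space: `λ^g(X) = λ(g X g⁻¹)`. -/
def coAct {J : NonUnitalSubalgebra F R} (g : ↥(algGroup F R J)) (lam : ↥J →ₗ[F] F) :
    ↥J →ₗ[F] F :=
  lam.comp ((lmulMap g).comp (rmulMap g⁻¹))

/-- The left orbit `Gλ`. -/
def leftOrbit (J : NonUnitalSubalgebra F R) (lam : ↥J →ₗ[F] F) : Set (↥J →ₗ[F] F) :=
  Set.range fun g : ↥(algGroup F R J) => leftAct g lam

/-- The right orbit `λG`. -/
def rightOrbit (J : NonUnitalSubalgebra F R) (lam : ↥J →ₗ[F] F) : Set (↥J →ₗ[F] F) :=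
  Set.range fun g : ↥(algGroup F R J) => rightAct g lam

/-- The two-sided orbit `GλG`. -/
def twoOrbit (J : NonUnitalSubalgebra F R) (lam : ↥J →ₗ[F] F) : Set (↥J →ₗ[F] F) :=
  {mu | ∃ g h : ↥(algGroup F R J), mu = leftAct g (rightAct h lam)}

/-- The coadjoint orbit `λ^G`. -/
def coOrbit (J : NonUnitalSubalgebra F R) (lam : ↥J →ₗ[F] F) : Set (↥J →ₗ[F] F) :=
  Set.range fun g : ↥(algGroup F R J) => coAct g lam

/-- The right orbit of `λ` under a subgroup `H` of the algebra group. -/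
def rightOrbitUnder (J : NonUnitalSubalgebra F R) (H : Subgroup ↥(algGroup F R J))
    (lam : ↥J →ₗ[F] F) : Set (↥J →ₗ[F] F) :=
  {mu | ∃ s ∈ H, mu = rightAct s lam}

/-- The Kirillov function `ψ_λ = |λ^G|^{-1/2} ∑_{μ ∈ λ^G} θ_μ`. -/
def kirillov (θ : AddChar F ℂ) (J : NonUnitalSubalgebra F R) (lam : ↥J →ₗ[F] F) :
    ↥(algGroup F R J) → ℂ :=
  fun g => ((Real.sqrt (Nat.card ↥(coOrbit J lam)) : ℂ))⁻¹ *
    ∑ᶠ mu ∈ coOrbit J lam, thetaFn θ J mu g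

/-- The supercharacter `χ_λ = (|Gλ|/|GλG|) ∑_{μ ∈ GλG} θ_μ`. -/
def superchar (θ : AddChar F ℂ) (J : NonUnitalSubalgebra F R) (lam : ↥J →ₗ[F] F) :
    ↥(algGroup F R J) → ℂ :=
  fun g => ((Nat.card ↥(leftOrbit J lam) : ℂ) / (Nat.card ↥(twoOrbit J lam) : ℂ)) *
    ∑ᶠ mu ∈ twoOrbit J lam, thetaFn θ J mu g

/-! ### The subalgebras `𝔩_λ`, `𝔰_λ` and their iterates -/

/-- The extension of `λ : J → F` by zero to all of `R`. -/
def lamE (J : NonUnitalSubalgebra F R) (lam : ↥J →ₗ[F] F) (x : R) : F :=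
  if h : x ∈ J then lam ⟨x, h⟩ else 0

theorem lamE_apply (J : NonUnitalSubalgebra F R) (lam : ↥J →ₗ[F] F) {x : R} (hx : x ∈ J) :
    lamE J lam x = lam ⟨x, hx⟩ := dif_pos hx

theorem lamE_zero (J : NonUnitalSubalgebra F R) (lam : ↥J →ₗ[F] F) : lamE J lam 0 = 0 := by
  rw [lamE_apply J lam J.zero_mem]
  have h : (⟨(0 : R), J.zero_mem⟩ : ↥J) = 0 := Subtype.ext rfl
  rw [h, map_zero]

theorem lamE_add (J : NonUnitalSubalgebra F R) (lam : ↥J →ₗ[F] F) {x y : R}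
    (hx : x ∈ J) (hy : y ∈ J) : lamE J lam (x + y) = lamE J lam x + lamE J lam y := by
  rw [lamE, lamE, lamE, dif_pos (add_mem hx hy), dif_pos hx, dif_pos hy]
  have h : (⟨x + y, add_mem hx hy⟩ : ↥J) = ⟨x, hx⟩ + ⟨y, hy⟩ := Subtype.ext rfl
  rw [h, map_add]

theorem lamE_smul (J : NonUnitalSubalgebra F R) (lam : ↥J →ₗ[F] F) (c : F) {x : R}
    (hx : x ∈ J) : lamE J lam (c • x) = c * lamE J lam x := by
  rw [lamE, lamE, dif_pos (SMulMemClass.smul_mem c hx), dif_pos hx]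
  have h : (⟨c • x, SMulMemClass.smul_mem c hx⟩ : ↥J) = c • ⟨x, hx⟩ := Subtype.ext rfl
  rw [h, map_smul]
  rfl

/-- The left kernel `𝔩` of the bilinear form `(X,Y) ↦ λ(XY)` restricted to `s × s`. -/
def lStep (J : NonUnitalSubalgebra F R) (lam : ↥J →ₗ[F] F)
    (s : NonUnitalSubalgebra F R) (hs : s ≤ J) : NonUnitalSubalgebra F R where
  carrier := {x | x ∈ s ∧ ∀ y ∈ s, lamE J lam (x * y) = 0}
  zero_mem' := ⟨zero_mem s, fun y _ => by rw [zero_mul, lamE_zero]⟩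
  add_mem' := by
    rintro a b ⟨ha1, ha2⟩ ⟨hb1, hb2⟩
    refine ⟨add_mem ha1 hb1, fun y hy => ?_⟩
    rw [add_mul, lamE_add J lam (J.mul_mem (hs ha1) (hs hy)) (J.mul_mem (hs hb1) (hs hy)),
      ha2 y hy, hb2 y hy, add_zero]
  smul_mem' := by
    rintro c a ⟨ha1, ha2⟩
    refine ⟨SMulMemClass.smul_mem c ha1, fun y hy => ?_⟩
    rw [smul_mul_assoc, lamE_smul J lam c (J.mul_mem (hs ha1) (hs hy)), ha2 y hy, mul_zero]
  mul_mem' := by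
    rintro a b ⟨ha1, ha2⟩ ⟨hb1, hb2⟩
    refine ⟨mul_mem ha1 hb1, fun y hy => ?_⟩
    rw [mul_assoc]
    exact ha2 (b * y) (mul_mem hb1 hy)

theorem lStep_le (J : NonUnitalSubalgebra F R) (lam : ↥J →ₗ[F] F)
    (s : NonUnitalSubalgebra F R) (hs : s ≤ J) : lStep J lam s hs ≤ s :=
  fun _ hx => hx.1

/-- The left kernel `𝔰` of the bilinear form `(X,Y) ↦ λ(XY)` restricted to `s × 𝔩`. -/
def sStep (J : NonUnitalSubalgebra F R) (lam : ↥J →ₗ[F] F)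
    (s : NonUnitalSubalgebra F R) (hs : s ≤ J) : NonUnitalSubalgebra F R where
  carrier := {x | x ∈ s ∧ ∀ y ∈ lStep J lam s hs, lamE J lam (x * y) = 0}
  zero_mem' := ⟨zero_mem s, fun y _ => by rw [zero_mul, lamE_zero]⟩
  add_mem' := by
    rintro a b ⟨ha1, ha2⟩ ⟨hb1, hb2⟩
    refine ⟨add_mem ha1 hb1, fun y hy => ?_⟩
    rw [add_mul, lamE_add J lam (J.mul_mem (hs ha1) (hs hy.1)) (J.mul_mem (hs hb1) (hs hy.1)),
      ha2 y hy, hb2 y hy, add_zero]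
  smul_mem' := by
    rintro c a ⟨ha1, ha2⟩
    refine ⟨SMulMemClass.smul_mem c ha1, fun y hy => ?_⟩
    rw [smul_mul_assoc, lamE_smul J lam c (J.mul_mem (hs ha1) (hs hy.1)), ha2 y hy, mul_zero]
  mul_mem' := by
    rintro a b ⟨ha1, ha2⟩ ⟨hb1, hb2⟩
    refine ⟨mul_mem ha1 hb1, fun y hy => ?_⟩
    rw [mul_assoc]
    refine ha2 (b * y) ⟨mul_mem hb1 hy.1, fun z hz => ?_⟩
    rw [mul_assoc]
    refine hb2 (y * z) ⟨mul_mem hy.1 hz, fun w hw => ?_⟩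
    rw [mul_assoc]
    exact hy.2 (z * w) (mul_mem hz hw)

theorem sStep_le (J : NonUnitalSubalgebra F R) (lam : ↥J →ₗ[F] F)
    (s : NonUnitalSubalgebra F R) (hs : s ≤ J) : sStep J lam s hs ≤ s :=
  fun _ hx => hx.1

/-- `𝔩_λ`: the left kernel of `(X,Y) ↦ λ(XY)` on `J × J`. -/
def lone (J : NonUnitalSubalgebra F R) (lam : ↥J →ₗ[F] F) : NonUnitalSubalgebra F R :=
  lStep J lam J le_rfl

/-- `𝔰_λ`: the left kernel of `(X,Y) ↦ λ(XY)` on `J × 𝔩_λ`. -/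
def sone (J : NonUnitalSubalgebra F R) (lam : ↥J →ₗ[F] F) : NonUnitalSubalgebra F R :=
  sStep J lam J le_rfl

theorem lone_le (J : NonUnitalSubalgebra F R) (lam : ↥J →ₗ[F] F) : lone J lam ≤ J :=
  lStep_le J lam J le_rfl

theorem sone_le (J : NonUnitalSubalgebra F R) (lam : ↥J →ₗ[F] F) : sone J lam ≤ J :=
  sStep_le J lam J le_rfl

/-- `𝔨_λ = 𝔩_λ ∩ ker λ`. -/
def kone (J : NonUnitalSubalgebra F R) (lam : ↥J →ₗ[F] F) : NonUnitalSubalgebra F R where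
  carrier := {x | x ∈ lone J lam ∧ lamE J lam x = 0}
  zero_mem' := ⟨zero_mem _, lamE_zero J lam⟩
  add_mem' := by
    rintro a b ⟨ha1, ha2⟩ ⟨hb1, hb2⟩
    exact ⟨add_mem ha1 hb1, by
      rw [lamE_add J lam (lone_le J lam ha1) (lone_le J lam hb1), ha2, hb2, add_zero]⟩
  smul_mem' := by
    rintro c a ⟨ha1, ha2⟩
    exact ⟨SMulMemClass.smul_mem c ha1, by
      rw [lamE_smul J lam c (lone_le J lam ha1), ha2, mul_zero]⟩
  mul_mem' := by
    rintro a b ⟨ha1, ha2⟩ ⟨hb1, hb2⟩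
    exact ⟨mul_mem ha1 hb1, ha1.2 b (lone_le J lam hb1)⟩

theorem kone_le (J : NonUnitalSubalgebra F R) (lam : ↥J →ₗ[F] F) : kone J lam ≤ lone J lam :=
  fun _ hx => hx.1

/-- The descending chain `𝔰_λ^0 ⊇ 𝔰_λ^1 ⊇ ⋯` (bundled with the proof `𝔰_λ^i ≤ J`). -/
def sChainAux (J : NonUnitalSubalgebra F R) (lam : ↥J →ₗ[F] F) :
    ℕ → {s : NonUnitalSubalgebra F R // s ≤ J}
  | 0 => ⟨J, le_rfl⟩
  | n + 1 =>
    ⟨sStep J lam (sChainAux J lam n).1 (sChainAux J lam n).2,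
      le_trans (sStep_le J lam (sChainAux J lam n).1 (sChainAux J lam n).2)
        (sChainAux J lam n).2⟩

/-- `𝔰_λ^i`. -/
def sChain (J : NonUnitalSubalgebra F R) (lam : ↥J →ₗ[F] F) (i : ℕ) :
    NonUnitalSubalgebra F R :=
  (sChainAux J lam i).1

/-- `𝔩_λ^{i+1}`. -/
def lChain (J : NonUnitalSubalgebra F R) (lam : ↥J →ₗ[F] F) (i : ℕ) :
    NonUnitalSubalgebra F R :=
  lStep J lam (sChainAux J lam i).1 (sChainAux J lam i).2

/-- The terminal element `𝔰̄_λ` of the descending chain; the chain has stabilized by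
stage `|R|` since it is a weakly decreasing chain of subalgebras of the finite algebra. -/
def sbar (J : NonUnitalSubalgebra F R) (lam : ↥J →ₗ[F] F) : NonUnitalSubalgebra F R :=
  sChain J lam (Fintype.card R)

theorem sbar_le (J : NonUnitalSubalgebra F R) (lam : ↥J →ₗ[F] F) : sbar J lam ≤ J :=
  (sChainAux J lam (Fintype.card R)).2

/-- The terminal element `𝔩̄_λ` of the ascending chain. -/
def lbar (J : NonUnitalSubalgebra F R) (lam : ↥J →ₗ[F] F) : NonUnitalSubalgebra F R :=
  lStep J lam (sbar J lam) (sbar_le J lam)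

theorem lbar_le (J : NonUnitalSubalgebra F R) (lam : ↥J →ₗ[F] F) : lbar J lam ≤ J :=
  le_trans (lStep_le J lam _ _) (sbar_le J lam)

/-! ### Algebra subgroups of an algebra group -/

/-- The algebra subgroup `1 + k` of `1 + J`, as a subgroup of the ambient algebra group. -/
def algSubgroup (k J : NonUnitalSubalgebra F R) : Subgroup ↥(algGroup F R J) :=
  (algGroup F R k).subgroupOf (algGroup F R J)

/-- `L_λ = 1 + 𝔩_λ` as a subgroup of `G`. -/
def Lgrp (J : NonUnitalSubalgebra F R) (lam : ↥J →ₗ[F] F) : Subgroup ↥(algGroup F R J) :=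
  algSubgroup (lone J lam) J

/-- `S_λ = 1 + 𝔰_λ` as a subgroup of `G`. -/
def Sgrp (J : NonUnitalSubalgebra F R) (lam : ↥J →ₗ[F] F) : Subgroup ↥(algGroup F R J) :=
  algSubgroup (sone J lam) J

/-- `L̄_λ = 1 + 𝔩̄_λ` as a subgroup of `G`. -/
def Lbarg (J : NonUnitalSubalgebra F R) (lam : ↥J →ₗ[F] F) : Subgroup ↥(algGroup F R J) :=
  algSubgroup (lbar J lam) J

/-- `S̄_λ = 1 + 𝔰̄_λ` as a subgroup of `G`. -/
def Sbarg (J : NonUnitalSubalgebra F R) (lam : ↥J →ₗ[F] F) : Subgroup ↥(algGroup F R J) :=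
  algSubgroup (sbar J lam) J

/-- Passing from an element of the subgroup `1 + k ≤ 1 + J` to an element of the
algebra group `1 + k` in its own right. -/
def toAlg {k J : NonUnitalSubalgebra F R} (x : ↥(algSubgroup k J)) : ↥(algGroup F R k) :=
  ⟨((x : ↥(algGroup F R J)) : Rˣ), Subgroup.mem_subgroupOf.mp x.2⟩

/-- The linear inclusion of a smaller subalgebra. -/
def inclMap {s J : NonUnitalSubalgebra F R} (h : s ≤ J) : ↥s →ₗ[F] ↥J where
  toFun x := ⟨(x : R), h x.2⟩
  map_add' x y := rfl
  map_smul' c x := rfl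

/-- Restriction of a functional on `J` to a smaller subalgebra. -/
def resTo {s J : NonUnitalSubalgebra F R} (h : s ≤ J) (lam : ↥J →ₗ[F] F) : ↥s →ₗ[F] F :=
  lam.comp (inclMap h)

/-- The character `ξ_λ = Ind_{L̄_λ}^G (θ_λ)`. -/
def xi (θ : AddChar F ℂ) (J : NonUnitalSubalgebra F R) (lam : ↥J →ₗ[F] F) :
    ↥(algGroup F R J) → ℂ :=
  indFun (Lbarg J lam) (fun x => thetaFn θ J lam ↑x)

/-- The set `Ξ_λ = {g λ s g⁻¹ : g ∈ G, s ∈ S̄_λ}`. -/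
def Xi (J : NonUnitalSubalgebra F R) (lam : ↥J →ₗ[F] F) : Set (↥J →ₗ[F] F) :=
  {nu | ∃ g : ↥(algGroup F R J), ∃ s ∈ Sbarg J lam, nu = coAct g (rightAct s lam)}

/-! ### Normality of algebra subgroups coming from ideals -/

theorem conj_mem_aux (s a : NonUnitalSubalgebra F R)
    (hl : ∀ x ∈ s, ∀ y ∈ a, x * y ∈ a) (hr : ∀ y ∈ a, ∀ x ∈ s, y * x ∈ a)
    (u : Rˣ) (hu1 : (u : R) - 1 ∈ s) (hu2 : ((u⁻¹ : Rˣ) : R) - 1 ∈ s)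
    (x : Rˣ) (hx : (x : R) - 1 ∈ a) : ((u * x * u⁻¹ : Rˣ) : R) - 1 ∈ a := by
  have h1 : (u : R) * ((u⁻¹ : Rˣ) : R) = 1 := Units.mul_inv u
  have key : ((u * x * u⁻¹ : Rˣ) : R) - 1 =
      ((u : R) - 1) * ((x : R) - 1) * (((u⁻¹ : Rˣ) : R) - 1) +
        ((u : R) - 1) * ((x : R) - 1) + ((x : R) - 1) * (((u⁻¹ : Rˣ) : R) - 1) +
        ((x : R) - 1) := by
    push_cast
    calc (u : R) * (x : R) * ((u⁻¹ : Rˣ) : R) - 1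
        = (u : R) * (x : R) * ((u⁻¹ : Rˣ) : R) - (u : R) * ((u⁻¹ : Rˣ) : R) := by rw [h1]
      _ = _ := by noncomm_ring
  rw [key]
  exact add_mem (add_mem (add_mem (hr _ (hl _ hu1 _ hx) _ hu2) (hl _ hu1 _ hx))
    (hr _ hx _ hu2)) hx

theorem algSubgroup_normal (s a : NonUnitalSubalgebra F R)
    (hl : ∀ x ∈ s, ∀ y ∈ a, x * y ∈ a) (hr : ∀ y ∈ a, ∀ x ∈ s, y * x ∈ a) :
    ((algGroup F R a).subgroupOf (algGroup F R s)).Normal := by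
  constructor
  intro n hn g
  rw [Subgroup.mem_subgroupOf] at hn ⊢
  have hginv : ((g⁻¹ : ↥(algGroup F R s)) : Rˣ) = ((g : Rˣ))⁻¹ := rfl
  have hcoe : ((g * n * g⁻¹ : ↥(algGroup F R s)) : Rˣ) = (g : Rˣ) * (n : Rˣ) * ((g : Rˣ))⁻¹ := by
    push_cast [hginv]; rfl
  rw [mem_algGroup]
  constructor
  · rw [hcoe]
    exact conj_mem_aux s a hl hr (g : Rˣ) (g : ↥(algGroup F R s)).2.1 (g : ↥(algGroup F R s)).2.2
      (n : Rˣ) hn.1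
  · have hinv : (((g * n * g⁻¹ : ↥(algGroup F R s)) : Rˣ))⁻¹ =
        (g : Rˣ) * ((n : Rˣ))⁻¹ * ((g : Rˣ))⁻¹ := by
      rw [hcoe]; group
    rw [hinv]
    exact conj_mem_aux s a hl hr (g : Rˣ) (g : ↥(algGroup F R s)).2.1 (g : ↥(algGroup F R s)).2.2
      ((n : Rˣ))⁻¹ hn.2

theorem lone_mul_mem (J : NonUnitalSubalgebra F R) (lam : ↥J →ₗ[F] F)
    {y z : R} (hy : y ∈ lone J lam) (hz : z ∈ J) : y * z ∈ lone J lam := by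
  refine ⟨J.mul_mem (lone_le J lam hy) hz, fun w hw => ?_⟩
  rw [mul_assoc]
  exact hy.2 (z * w) (J.mul_mem hz hw)

theorem sone_mul_lone_mem (J : NonUnitalSubalgebra F R) (lam : ↥J →ₗ[F] F)
    {x y : R} (hx : x ∈ sone J lam) (hy : y ∈ lone J lam) : x * y ∈ lone J lam := by
  refine ⟨J.mul_mem (sone_le J lam hx) (lone_le J lam hy), fun w hw => ?_⟩
  rw [mul_assoc]
  exact hx.2 (y * w) (lone_mul_mem J lam hy hw)

theorem kone_ideal_left (J : NonUnitalSubalgebra F R) (lam : ↥J →ₗ[F] F) :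
    ∀ x ∈ sone J lam, ∀ y ∈ kone J lam, x * y ∈ kone J lam := by
  intro x hx y hy
  exact ⟨sone_mul_lone_mem J lam hx hy.1, hx.2 y hy.1⟩

theorem kone_ideal_right (J : NonUnitalSubalgebra F R) (lam : ↥J →ₗ[F] F) :
    ∀ y ∈ kone J lam, ∀ x ∈ sone J lam, y * x ∈ kone J lam := by
  intro y hy x hx
  exact ⟨lone_mul_mem J lam hy.1 (sone_le J lam hx), hy.1.2 x (sone_le J lam hx)⟩

/-- `K_λ = 1 + 𝔨_λ` as a (normal) subgroup of `S_λ = 1 + 𝔰_λ`. -/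
def KgrpIn (J : NonUnitalSubalgebra F R) (lam : ↥J →ₗ[F] F) :
    Subgroup ↥(algGroup F R (sone J lam)) :=
  (algGroup F R (kone J lam)).subgroupOf (algGroup F R (sone J lam))

instance KgrpIn_normal (J : NonUnitalSubalgebra F R) (lam : ↥J →ₗ[F] F) :
    (KgrpIn J lam).Normal :=
  algSubgroup_normal (sone J lam) (kone J lam) (kone_ideal_left J lam) (kone_ideal_right J lam)

/-- `L_λ = 1 + 𝔩_λ` as a (normal) subgroup of `S_λ = 1 + 𝔰_λ`. -/
def LgrpIn (J : NonUnitalSubalgebra F R) (lam : ↥J →ₗ[F] F) :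
    Subgroup ↥(algGroup F R (sone J lam)) :=
  (algGroup F R (lone J lam)).subgroupOf (algGroup F R (sone J lam))

instance LgrpIn_normal (J : NonUnitalSubalgebra F R) (lam : ↥J →ₗ[F] F) :
    (LgrpIn J lam).Normal :=
  algSubgroup_normal (sone J lam) (lone J lam)
    (fun x hx y hy => sone_mul_lone_mem J lam hx hy)
    (fun y hy x hx => lone_mul_mem J lam hy (sone_le J lam hx))

/-! ### Units congruent to one modulo a subalgebra -/

theorem mem_algGroup_of_sub_one_mem {A : NonUnitalSubalgebra F R} {u : Rˣ}
    (hu : (u : R) - 1 ∈ A) : u ∈ algGroup F R A := by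
  refine ⟨hu, ?_⟩
  have hpow : ∀ n : ℕ, ((u ^ n : Rˣ) : R) - 1 ∈ A := by
    intro n
    induction n with
    | zero => simp
    | succ n ih =>
      have h : ((u ^ (n + 1) : Rˣ) : R) - 1 =
          (((u ^ n : Rˣ) : R) - 1) * ((u : R) - 1) + (((u ^ n : Rˣ) : R) - 1) + ((u : R) - 1) := by
        rw [pow_succ]; push_cast; noncomm_ring
      rw [h]
      exact add_mem (add_mem (mul_mem ih hu) ih) hu
  have hinv : u⁻¹ = u ^ (orderOf u - 1) := by
    rw [inv_eq_iff_mul_eq_one, ← pow_succ', Nat.sub_add_cancel (orderOf_pos u), pow_orderOf_eq_one]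
  rw [hinv]
  exact hpow _

theorem algGroup_mono {A B : NonUnitalSubalgebra F R} (h : A ≤ B) :
    algGroup F R A ≤ algGroup F R B :=
  fun _ hu => ⟨h hu.1, h hu.2⟩

theorem mul_unit_mem {A B : NonUnitalSubalgebra F R} (hBA : ∀ b ∈ B, ∀ a ∈ A, b * a ∈ B)
    {u : Rˣ} (hu : u ∈ algGroup F R A) {b : R} (hb : b ∈ B) : b * (u : R) ∈ B := by
  have h : b * (u : R) = b * ((u : R) - 1) + b := by noncomm_ring
  rw [h]
  exact add_mem (hBA b hb _ hu.1) hb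

theorem unit_mul_mem {A B : NonUnitalSubalgebra F R} (hAB : ∀ a ∈ A, ∀ b ∈ B, a * b ∈ B)
    {u : Rˣ} (hu : u ∈ algGroup F R A) {b : R} (hb : b ∈ B) : (u : R) * b ∈ B := by
  have h : (u : R) * b = ((u : R) - 1) * b + b := by noncomm_ring
  rw [h]
  exact add_mem (hAB _ hu.1 b hb) hb

theorem conj_unit_mem {A B : NonUnitalSubalgebra F R} (hAB : ∀ a ∈ A, ∀ b ∈ B, a * b ∈ B)
    (hBA : ∀ b ∈ B, ∀ a ∈ A, b * a ∈ B) {u : Rˣ} (hu : u ∈ algGroup F R A) {b : R}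
    (hb : b ∈ B) : (u : R) * b * ((u⁻¹ : Rˣ) : R) ∈ B :=
  mul_unit_mem hBA (inv_mem hu) (unit_mul_mem hAB hu hb)

theorem IsNil.isNilpotent {J : NonUnitalSubalgebra F R} (hJ : IsNil J) {x : R} (hx : x ∈ J) :
    IsNilpotent x := by
  obtain ⟨N, hN⟩ := hJ
  refine ⟨N, ?_⟩
  rw [← List.prod_replicate]
  exact hN _ (fun y hy => (List.eq_of_mem_replicate hy) ▸ hx) List.length_replicate

theorem IsNil.exists_unit {J : NonUnitalSubalgebra F R} (hJ : IsNil J)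
    {A : NonUnitalSubalgebra F R} (hA : A ≤ J) {x : R} (hx : x ∈ A) :
    ∃ u ∈ algGroup F R A, (u : R) = 1 + x := by
  obtain ⟨u, hu⟩ := (hJ.isNilpotent (hA hx)).isUnit_one_add
  exact ⟨u, mem_algGroup_of_sub_one_mem (by rw [hu, add_sub_cancel_left]; exact hx), hu⟩

theorem IsNil.card_algGroup {J : NonUnitalSubalgebra F R} (hJ : IsNil J)
    {A : NonUnitalSubalgebra F R} (hA : A ≤ J) :
    Nat.card ↥(algGroup F R A) = Nat.card ↥A := by
  refine Nat.card_eq_of_bijective (gElt (J := A)) ⟨fun u v huv => ?_, fun x => ?_⟩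
  · have h : ((u : Rˣ) : R) - 1 = ((v : Rˣ) : R) - 1 := congrArg Subtype.val huv
    exact Subtype.ext (Units.ext (sub_left_inj.mp h))
  · obtain ⟨u, hu, hux⟩ := hJ.exists_unit hA x.2
    refine ⟨⟨u, hu⟩, Subtype.ext ?_⟩
    change (u : R) - 1 = x
    rw [hux, add_sub_cancel_left]

theorem card_algSubgroup {k J : NonUnitalSubalgebra F R} (h : k ≤ J) :
    Nat.card ↥(algSubgroup k J) = Nat.card ↥(algGroup F R k) :=
  Nat.card_congr (Subgroup.subgroupOfEquivOfLe (algGroup_mono h)).toEquiv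

/-! ### Chains of left kernels of a functional on the whole algebra -/

/-- Every functional on `A` which kills the left kernel in `A` of the pairing
`(x, y) ↦ Λ (x * y)` on `A × B` is of the form `x ↦ Λ (x * y)` for some `y ∈ B`. -/
theorem exists_eq_apply_mul (A B : Submodule F R) (Λ f : R →ₗ[F] F)
    (hf : ∀ x ∈ A, (∀ y ∈ B, Λ (x * y) = 0) → f x = 0) :
    ∃ y ∈ B, ∀ x ∈ A, f x = Λ (x * y) := by
  have : Module.Finite F R := Module.Finite.of_finite
  let φ : ↥B →ₗ[F] Module.Dual F ↥A := LinearMap.mk₂ F (fun y x => Λ ((x : R) * (y : R)))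
    (fun y y' x => by simp [mul_add]) (fun c y x => by simp)
    (fun y x x' => by simp [add_mul]) (fun c y x => by simp)
  have hmem : f.domRestrict A ∈ φ.range := by
    rw [← Subspace.dualCoannihilator_dualAnnihilator_eq (W := φ.range),
      Submodule.mem_dualAnnihilator]
    intro x hx
    rw [Submodule.mem_dualCoannihilator] at hx
    exact hf x x.2 fun y hy => hx _ ⟨⟨y, hy⟩, rfl⟩
  obtain ⟨y, hy⟩ := hmem
  exact ⟨y, y.2, fun x hx => (LinearMap.congr_fun hy ⟨x, hx⟩).symm⟩

/-- The sequences of subalgebras `s` and `l` are built from the functional `Λ` by iteratively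
taking left kernels of `(x, y) ↦ Λ (x * y)`. -/
structure IsKernelChain (Λ : R →ₗ[F] F) (s l : ℕ → NonUnitalSubalgebra F R) : Prop where
  mem_l : ∀ i x, x ∈ l i ↔ x ∈ s i ∧ ∀ y ∈ s i, Λ (x * y) = 0
  mem_s : ∀ i x, x ∈ s (i + 1) ↔ x ∈ s i ∧ ∀ y ∈ l i, Λ (x * y) = 0

namespace IsKernelChain

variable {Λ : R →ₗ[F] F} {s l : ℕ → NonUnitalSubalgebra F R}

theorem s_antitone (hc : IsKernelChain Λ s l) : Antitone s :=
  antitone_nat_of_succ_le fun i x hx => ((hc.mem_s i x).1 hx).1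

theorem l_le_s_self (hc : IsKernelChain Λ s l) (i : ℕ) : l i ≤ s i :=
  fun x hx => ((hc.mem_l i x).1 hx).1

theorem l_le_s_succ (hc : IsKernelChain Λ s l) (i : ℕ) : l i ≤ s (i + 1) := fun x hx =>
  (hc.mem_s i x).2 ⟨hc.l_le_s_self i hx,
    fun y hy => ((hc.mem_l i x).1 hx).2 y (hc.l_le_s_self i hy)⟩

theorem l_monotone (hc : IsKernelChain Λ s l) : Monotone l :=
  monotone_nat_of_le_succ fun i x hx => (hc.mem_l (i + 1) x).2
    ⟨hc.l_le_s_succ i hx,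
      fun y hy => ((hc.mem_l i x).1 hx).2 y (hc.s_antitone (Nat.le_succ i) hy)⟩

theorem l_le_s (hc : IsKernelChain Λ s l) (i j : ℕ) : l i ≤ s j := by
  rcases le_total i j with h | h
  · exact (hc.l_monotone h).trans (hc.l_le_s_self j)
  · exact (hc.l_le_s_self i).trans (hc.s_antitone h)

theorem l_mul_s (hc : IsKernelChain Λ s l) (i : ℕ) : ∀ x ∈ l i, ∀ y ∈ s i, x * y ∈ l i := by
  intro x hx y hy
  refine (hc.mem_l i _).2 ⟨mul_mem (hc.l_le_s_self i hx) hy, fun z hz => ?_⟩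
  rw [mul_assoc]
  exact ((hc.mem_l i x).1 hx).2 _ (mul_mem hy hz)

theorem s_mul_l (hc : IsKernelChain Λ s l) (i : ℕ) :
    ∀ x ∈ s (i + 1), ∀ y ∈ l i, x * y ∈ l i := by
  intro x hx y hy
  refine (hc.mem_l i _).2
    ⟨mul_mem (hc.s_antitone (Nat.le_succ i) hx) (hc.l_le_s_self i hy), fun z hz => ?_⟩
  rw [mul_assoc]
  exact ((hc.mem_s i x).1 hx).2 _ (hc.l_mul_s i y hy z hz)

theorem s_succ_eq_of_eq (hc : IsKernelChain Λ s l) {i : ℕ} (h : s i = s (i + 1)) :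
    s (i + 1) = s (i + 2) := by
  have hl : l i = l (i + 1) := by
    ext x
    rw [hc.mem_l, hc.mem_l, h]
  ext x
  rw [hc.mem_s i, hc.mem_s (i + 1), ← h, ← hl]

theorem s_card_eq (hc : IsKernelChain Λ s l) :
    s (Fintype.card R) = s (Fintype.card R + 1) := by
  have key : ∀ i, s i = s (i + 1) ∨ Nat.card ↥(s (i + 1)) + (i + 1) ≤ Nat.card R := by
    have hlt : ∀ i, s i ≠ s (i + 1) → Nat.card ↥(s (i + 1)) < Nat.card ↥(s i) := by
      intro i hi
      have hss : (s (i + 1) : Set R) ⊂ (s i : Set R) :=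
        SetLike.coe_ssubset_coe.2 (lt_of_le_of_ne (hc.s_antitone (Nat.le_succ i)) hi.symm)
      exact Set.ncard_lt_ncard hss (Set.toFinite _)
    intro i
    induction i with
    | zero =>
      refine or_iff_not_imp_left.2 fun hi => ?_
      have h1 := hlt 0 hi
      have h2 : Nat.card ↥(s 0) ≤ Nat.card R := Finite.card_subtype_le _
      omega
    | succ i ih =>
      refine or_iff_not_imp_left.2 fun hi => ?_
      have h1 := hlt (i + 1) hi
      rcases ih with h | h
      · exact absurd (hc.s_succ_eq_of_eq h) hi
      · omega
  refine (key _).resolve_right fun h => ?_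
  rw [Nat.card_eq_fintype_card (α := R)] at h
  omega

variable {N : ℕ}

theorem apply_unit_conj (hc : IsKernelChain Λ s l) (hN : s N = s (N + 1)) {u : Rˣ}
    (hu : u ∈ algGroup F R (s N)) {x : R} (hx : x ∈ l N) :
    Λ ((u : R) * x * ((u⁻¹ : Rˣ) : R)) = Λ x := by
  have hux : ((u : R) - 1) * x ∈ l N := hc.s_mul_l N _ (hN ▸ hu.1) x hx
  have h : (u : R) * x * ((u⁻¹ : Rˣ) : R) =
      x + ((u : R) - 1) * x + (((u : R) - 1) * x + x) * (((u⁻¹ : Rˣ) : R) - 1) := by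
    noncomm_ring
  rw [h, map_add, map_add, ((hc.mem_s N _).1 (hN ▸ hu.1)).2 x hx,
    ((hc.mem_l N _).1 (add_mem hux hx)).2 _ hu.2, add_zero, add_zero]

theorem conj_mem_l (hc : IsKernelChain Λ s l) (hN : s N = s (N + 1)) {u : Rˣ}
    (hu : u ∈ algGroup F R (s N)) {x : R} (hx : x ∈ l N) :
    (u : R) * x * ((u⁻¹ : Rˣ) : R) ∈ l N :=
  conj_unit_mem (fun a ha => hc.s_mul_l N a (hN ▸ ha)) (hc.l_mul_s N) hu hx

theorem apply_mul_unit (hc : IsKernelChain Λ s l) {i : ℕ} {u : Rˣ}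
    (hu : u ∈ algGroup F R (s i)) {x : R} (hx : x ∈ l i) : Λ (x * (u : R)) = Λ x := by
  have h : x * (u : R) = x * ((u : R) - 1) + x := by noncomm_ring
  rw [h, map_add, ((hc.mem_l i x).1 hx).2 _ hu.1, zero_add]

theorem conj_mem_s (i : ℕ) {u : Rˣ} (hu : u ∈ algGroup F R (s i)) {x : R} (hx : x ∈ s i) :
    (u : R) * x * ((u⁻¹ : Rˣ) : R) ∈ s i :=
  conj_unit_mem (fun _ ha _ hb => mul_mem ha hb) (fun _ hb _ ha => mul_mem hb ha) hu hx

/-- Conjugation by a unit as a linear endomorphism. -/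
def unitConj (F : Type) [Field F] {R : Type} [Ring R] [Algebra F R] (u : Rˣ) : R →ₗ[F] R :=
  (LinearMap.mulLeft F (u : R)).comp (LinearMap.mulRight F ((u⁻¹ : Rˣ) : R))

theorem unitConj_apply (u : Rˣ) (x : R) :
    unitConj F u x = (u : R) * x * ((u⁻¹ : Rˣ) : R) := by
  simp [unitConj, mul_assoc]

/-- A functional agreeing with `Λ` on some `s k` is conjugate to `Λ` on `s 0`. -/
theorem exists_conj_of_eqOn_s (hc : IsKernelChain Λ s l) (hJ : IsNil (s 0)) (N k : ℕ) :
    ∀ M : R →ₗ[F] F, (∀ x ∈ s k, M x = Λ x) →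
      ∃ h ∈ algGroup F R (s N), ∀ x ∈ s 0, M x = Λ ((h : R) * x * ((h⁻¹ : Rˣ) : R)) := by
  induction k with
  | zero => exact fun M hM => ⟨1, one_mem _, fun x hx => by simpa using hM x hx⟩
  | succ k ih =>
    intro M hM
    obtain ⟨y, hy, hMy⟩ := exists_eq_apply_mul (s k).toSubmodule (l k).toSubmodule Λ (M - Λ)
      (fun x hx hxy => by
        rw [LinearMap.sub_apply, hM x ((hc.mem_s k x).2 ⟨hx, hxy⟩), sub_self])
    obtain ⟨u, hu, huy⟩ := hJ.exists_unit (hc.l_le_s k 0) hy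
    have hM' : ∀ x ∈ s k, M x = Λ (x * (u : R)) := by
      intro x hx
      rw [huy, mul_add, mul_one, map_add, ← hMy x hx, LinearMap.sub_apply, add_sub_cancel]
    have hconj : ∀ x ∈ s k, M ((u : R) * x * ((u⁻¹ : Rˣ) : R)) = Λ x := by
      intro x hx
      rw [hM' _ (conj_mem_s k (algGroup_mono (hc.l_le_s k k) hu) hx), Units.inv_mul_cancel_right]
      have h : (u : R) * x = ((u : R) - 1) * x + x := by noncomm_ring
      rw [h, map_add, ((hc.mem_l k _).1 hu.1).2 x hx, zero_add]
    obtain ⟨h, hh, hMh⟩ := ih (M.comp (unitConj F u)) (fun x hx => by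
      rw [LinearMap.comp_apply, unitConj_apply, hconj x hx])
    refine ⟨h * u⁻¹, mul_mem hh (inv_mem (algGroup_mono (hc.l_le_s k N) hu)), fun x hx => ?_⟩
    have h1 := hMh _ (conj_mem_s 0 (inv_mem (algGroup_mono (hc.l_le_s k 0) hu)) hx)
    rw [LinearMap.comp_apply, unitConj_apply] at h1
    simpa [mul_assoc] using h1

/-- A functional agreeing with `Λ` on the terminal `l N` is conjugate to a right translate
of `Λ`, with both conjugating and translating elements in `1 + s N`. -/
theorem exists_conj_of_eqOn_l (hc : IsKernelChain Λ s l) (hJ : IsNil (s 0)) (N : ℕ)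
    (M : R →ₗ[F] F) (hM : ∀ x ∈ l N, M x = Λ x) :
    ∃ h ∈ algGroup F R (s N), ∃ t ∈ algGroup F R (s N),
      ∀ x ∈ s 0, M x = Λ ((h : R) * x * ((h⁻¹ : Rˣ) : R) * (t : R)) := by
  obtain ⟨y, hy, hMy⟩ := exists_eq_apply_mul (s N).toSubmodule (s N).toSubmodule Λ (M - Λ)
    (fun x hx hxy => by
      rw [LinearMap.sub_apply, hM x ((hc.mem_l N x).2 ⟨hx, hxy⟩), sub_self])
  have hs0 : s N ≤ s 0 := hc.s_antitone (Nat.zero_le N)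
  obtain ⟨u, hu, huy⟩ := hJ.exists_unit hs0 hy
  have hM' : ∀ x ∈ s N, M x = Λ (x * (u : R)) := by
    intro x hx
    rw [huy, mul_add, mul_one, map_add, ← hMy x hx, LinearMap.sub_apply, add_sub_cancel]
  have hmul : ∀ {i : ℕ} {v : Rˣ} {x : R}, v ∈ algGroup F R (s i) → x ∈ s i →
      x * (v : R) ∈ s i :=
    fun hv hx => mul_unit_mem (fun _ hb _ ha => mul_mem hb ha) hv hx
  obtain ⟨h, hh, hMh⟩ := hc.exists_conj_of_eqOn_s hJ N N
    (M.comp (LinearMap.mulRight F ((u⁻¹ : Rˣ) : R))) (fun x hx => by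
      rw [LinearMap.comp_apply, LinearMap.mulRight_apply, hM' _ (hmul (inv_mem hu) hx),
        Units.inv_mul_cancel_right])
  refine ⟨h, hh, h * u * h⁻¹, mul_mem (mul_mem hh hu) (inv_mem hh), fun x hx => ?_⟩
  have h1 := hMh _ (hmul (algGroup_mono hs0 hu) hx)
  rw [LinearMap.comp_apply, LinearMap.mulRight_apply, Units.mul_inv_cancel_right] at h1
  rw [h1]
  simp [mul_assoc]

/-- If `M` and its conjugate by `g` both agree with `Λ` on `l N`, then `g ∈ 1 + s N`. -/
theorem mem_of_eqOn_l (hc : IsKernelChain Λ s l) (hJ : IsNil (s 0)) (N : ℕ)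
    (M : R →ₗ[F] F) (hM : ∀ x ∈ l N, M x = Λ x) {g : Rˣ} (hg : g ∈ algGroup F R (s 0))
    (hMg : ∀ x ∈ l N, M ((g : R) * x * ((g⁻¹ : Rˣ) : R)) = Λ x) :
    g ∈ algGroup F R (s N) := by
  obtain ⟨h, hh, t, ht, hMht⟩ := hc.exists_conj_of_eqOn_l hJ N M hM
  have hs0 : s N ≤ s 0 := hc.s_antitone (Nat.zero_le N)
  have key : ∀ x ∈ l N,
      Λ (((h * g : Rˣ) : R) * x * (((h * g)⁻¹ : Rˣ) : R) * (t : R)) = Λ x := by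
    intro x hx
    rw [← hMg x hx, hMht _ (conj_mem_s 0 hg (hc.l_le_s N 0 hx))]
    simp [mul_assoc]
  have hmem : ∀ i, i ≤ N → h * g ∈ algGroup F R (s i) := by
    intro i
    induction i with
    | zero => exact fun _ => mul_mem (algGroup_mono hs0 hh) hg
    | succ i ih =>
      intro hi
      have hgi := ih (Nat.le_of_succ_le hi)
      have hti := algGroup_mono (hc.s_antitone (Nat.le_of_succ_le hi)) ht
      refine mem_algGroup_of_sub_one_mem ((hc.mem_s i _).2 ⟨hgi.1, fun x hx => ?_⟩)
      have hxt := mul_unit_mem (hc.l_mul_s i) (inv_mem hti) hx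
      have hxtg := mul_unit_mem (hc.l_mul_s i) hgi hxt
      have h1 := key _ (hc.l_monotone (Nat.le_of_succ_le hi) hxtg)
      rw [hc.apply_mul_unit hgi hxt, hc.apply_mul_unit (inv_mem hti) hx, ← mul_assoc,
        Units.mul_inv_cancel_right, ← mul_assoc, Units.inv_mul_cancel_right] at h1
      rw [sub_mul, one_mul, map_sub, h1, sub_self]
  have := mul_mem (inv_mem hh) (hmem N le_rfl)
  rwa [inv_mul_cancel_left] at this

end IsKernelChain

/-! ### Functionals on the subalgebra -/

variable {J : NonUnitalSubalgebra F R}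

theorem exists_extension (mu : ↥J →ₗ[F] F) :
    ∃ M : R →ₗ[F] F, ∀ x (hx : x ∈ J), M x = mu ⟨x, hx⟩ := by
  obtain ⟨M, hM⟩ := LinearMap.exists_extend (p := J.toSubmodule) mu
  exact ⟨M, fun x hx => LinearMap.congr_fun hM ⟨x, hx⟩⟩

theorem isKernelChain {lam : ↥J →ₗ[F] F} {Λ : R →ₗ[F] F}
    (hΛ : ∀ x (hx : x ∈ J), Λ x = lam ⟨x, hx⟩) :
    IsKernelChain Λ (sChain J lam) (lChain J lam) := by
  have hE : ∀ {x : R}, x ∈ J → Λ x = lamE J lam x := fun hx => by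
    rw [lamE_apply J lam hx, hΛ _ hx]
  have hs : ∀ i, sChain J lam i ≤ J := fun i => (sChainAux J lam i).2
  refine ⟨fun i x => ?_, fun i x => ?_⟩
  · refine and_congr_right fun hx => forall₂_congr fun y hy => ?_
    rw [hE (mul_mem (hs i hx) (hs i hy))]
  · refine and_congr_right fun hx => forall₂_congr fun y hy => ?_
    rw [hE (mul_mem (hs i hx) (hs i hy.1))]

theorem gElt_conj (x g : ↥(algGroup F R J)) :
    gElt (x * g * x⁻¹) = lmulMap x (rmulMap x⁻¹ (gElt g)) := by
  refine Subtype.ext ?_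
  change (((x : Rˣ) * (g : Rˣ) * (x : Rˣ)⁻¹ : Rˣ) : R) - 1 =
    ((x : Rˣ) : R) * ((((g : Rˣ) : R) - 1) * (((x : Rˣ)⁻¹ : Rˣ) : R))
  push_cast
  rw [sub_mul, mul_sub, one_mul, Units.mul_inv, mul_assoc]

theorem thetaFn_conj (θ : AddChar F ℂ) (mu : ↥J →ₗ[F] F) (x g : ↥(algGroup F R J)) :
    thetaFn θ J mu (x * g * x⁻¹) = thetaFn θ J (coAct x mu) g := by
  rw [thetaFn, gElt_conj]
  rfl

theorem coAct_coAct (x y : ↥(algGroup F R J)) (mu : ↥J →ₗ[F] F) :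
    coAct x (coAct y mu) = coAct (y * x) mu := by
  ext X
  refine congrArg mu (Subtype.ext ?_)
  change ((y : Rˣ) : R) * ((((x : Rˣ) : R) * ((X : R) * (((x : Rˣ)⁻¹ : Rˣ) : R))) *
      (((y : Rˣ)⁻¹ : Rˣ) : R)) =
    (((y : Rˣ) * (x : Rˣ) : Rˣ) : R) * ((X : R) * ((((y : Rˣ) * (x : Rˣ))⁻¹ : Rˣ) : R))
  rw [mul_inv_rev]
  push_cast
  simp only [mul_assoc]

theorem coAct_one (mu : ↥J →ₗ[F] F) : coAct 1 mu = mu := by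
  ext X
  refine congrArg mu (Subtype.ext ?_)
  change ((1 : Rˣ) : R) * ((X : R) * (((1 : Rˣ)⁻¹ : Rˣ) : R)) = X
  simp

/-- The functionals on `J` which agree with `lam` on the terminal subalgebra `lbar J lam`. -/
def lbarAgree (J : NonUnitalSubalgebra F R) (lam : ↥J →ₗ[F] F) : Set (↥J →ₗ[F] F) :=
  {mu | ∀ X : ↥J, (X : R) ∈ lbar J lam → mu X = lam X}

theorem coAct_mem_lbarAgree_iff (hJ : IsNil J) {lam mu : ↥J →ₗ[F] F}
    (hmu : mu ∈ lbarAgree J lam) (g : ↥(algGroup F R J)) :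
    coAct g mu ∈ lbarAgree J lam ↔ g ∈ Sbarg J lam := by
  obtain ⟨Λ, hΛ⟩ := exists_extension lam
  obtain ⟨M, hM⟩ := exists_extension mu
  have hc := isKernelChain hΛ
  have hN := hc.s_card_eq
  have hMl : ∀ x ∈ lChain J lam (Fintype.card R), M x = Λ x := fun x hx => by
    rw [hM x (lbar_le J lam hx), hΛ x (lbar_le J lam hx)]
    exact hmu ⟨x, lbar_le J lam hx⟩ hx
  have hco : ∀ X : ↥J, coAct g mu X =
      M (((g : Rˣ) : R) * (X : R) * (((g : Rˣ)⁻¹ : Rˣ) : R)) := fun X => by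
    have hX : ((g : Rˣ) : R) * (X : R) * (((g : Rˣ)⁻¹ : Rˣ) : R) ∈ J :=
      conj_unit_mem (fun _ ha _ hb => mul_mem ha hb) (fun _ hb _ ha => mul_mem hb ha) g.2 X.2
    rw [hM _ hX]
    exact congrArg mu (Subtype.ext (mul_assoc _ _ _).symm)
  rw [Sbarg, algSubgroup, Subgroup.mem_subgroupOf]
  constructor
  · intro hg
    refine hc.mem_of_eqOn_l hJ _ M hMl g.2 fun x hx => ?_
    have h := hg ⟨x, lbar_le J lam hx⟩ hx
    rw [hco] at h
    rw [hΛ x (lbar_le J lam hx), ← h]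
  · intro hg X hX
    rw [hco, hMl _ (hc.conj_mem_l hN hg hX), hc.apply_unit_conj hN hg hX, hΛ _ X.2]

theorem rightAct_mem_lbarAgree (lam : ↥J →ₗ[F] F) {t : ↥(algGroup F R J)}
    (ht : t ∈ Sbarg J lam) : rightAct t lam ∈ lbarAgree J lam := by
  obtain ⟨Λ, hΛ⟩ := exists_extension lam
  have hc := isKernelChain hΛ
  intro X hX
  have h := hc.apply_mul_unit (inv_mem (Subgroup.mem_subgroupOf.mp ht)) hX
  rw [hΛ _ X.2, hΛ _ (mul_unit_mem (fun _ hb _ ha => mul_mem hb ha) (inv_mem t.2) X.2)] at h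
  exact h

/-- `Xi J lam` is the coadjoint saturation of `lbarAgree J lam`. -/
theorem Xi_eq (hJ : IsNil J) (lam : ↥J →ₗ[F] F) :
    Xi J lam = {nu | ∃ g : ↥(algGroup F R J), ∃ mu ∈ lbarAgree J lam, coAct g mu = nu} := by
  ext nu
  constructor
  · rintro ⟨g, t, ht, rfl⟩
    exact ⟨g, _, rightAct_mem_lbarAgree lam ht, rfl⟩
  · rintro ⟨g, mu, hmu, rfl⟩
    obtain ⟨Λ, hΛ⟩ := exists_extension lam
    obtain ⟨M, hM⟩ := exists_extension mu
    have hc := isKernelChain hΛ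
    obtain ⟨h, hh, t, ht, hMht⟩ := hc.exists_conj_of_eqOn_l hJ (Fintype.card R) M
      (fun x hx => by
        rw [hM x (lbar_le J lam hx), hΛ x (lbar_le J lam hx)]
        exact hmu ⟨x, lbar_le J lam hx⟩ hx)
    have hmono := algGroup_mono (sbar_le J lam)
    refine ⟨⟨h, hmono hh⟩ * g, ⟨t, hmono ht⟩⁻¹, inv_mem (Subgroup.mem_subgroupOf.mpr ht), ?_⟩
    rw [← coAct_coAct]
    congr 1
    ext X
    have hX : (h : R) * (X : R) * ((h⁻¹ : Rˣ) : R) * (t : R) ∈ J :=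
      mul_unit_mem (fun _ hb _ ha => mul_mem hb ha) (hmono ht)
        (conj_unit_mem (fun _ ha _ hb => mul_mem ha hb) (fun _ hb _ ha => mul_mem hb ha)
          (hmono hh) X.2)
    have h1 := hMht X X.2
    rw [hM _ X.2, hΛ _ hX] at h1
    refine h1.trans (congrArg lam (Subtype.ext ?_))
    change (h : R) * (X : R) * ((h⁻¹ : Rˣ) : R) * (t : R) =
      (h : R) * ((X : R) * ((h⁻¹ : Rˣ) : R)) * (((t⁻¹)⁻¹ : Rˣ) : R)
    rw [inv_inv, mul_assoc (h : R)]

instance finite_dual (J : NonUnitalSubalgebra F R) : Finite (↥J →ₗ[F] F) :=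
  DFunLike.finite _

/-- Averaging a function over the coadjoint translates of `lbarAgree J lam`. -/
theorem sum_coAct_lbarAgree (hJ : IsNil J) (lam : ↥J →ₗ[F] F) (f : (↥J →ₗ[F] F) → ℂ) :
    ∑ᶠ x : ↥(algGroup F R J), ∑ᶠ mu ∈ lbarAgree J lam, f (coAct x mu) =
      (Nat.card ↥(Sbarg J lam) : ℂ) * ∑ᶠ nu ∈ Xi J lam, f nu := by
  have := Fintype.ofFinite (↥J →ₗ[F] F)
  have := Fintype.ofFinite ↥(algGroup F R J)
  rw [finsum_eq_sum_of_fintype]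
  simp_rw [finsum_mem_eq_toFinset_sum]
  rw [← Finset.sum_product' (f := fun x mu => f (coAct x mu)), Finset.mul_sum,
    ← Finset.sum_fiberwise_of_maps_to (t := (Xi J lam).toFinset)
      (g := fun p : ↥(algGroup F R J) × (↥J →ₗ[F] F) => coAct p.1 p.2)]
  · refine Finset.sum_congr rfl fun nu hnu => ?_
    rw [Set.mem_toFinset, Xi_eq hJ] at hnu
    obtain ⟨x₀, mu₀, hmu₀, rfl⟩ := hnu
    rw [Finset.sum_congr rfl (g := fun _ => f (coAct x₀ mu₀))
      (fun p hp => by rw [(Finset.mem_filter.1 hp).2]), Finset.sum_const, nsmul_eq_mul]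
    congr 2
    rw [Nat.card_eq_fintype_card, ← Finset.card_univ]
    symm
    refine Finset.card_bij
      (fun (t : ↥(Sbarg J lam)) _ => ((t : ↥(algGroup F R J))⁻¹ * x₀, coAct t mu₀)) ?_ ?_ ?_
    · intro t _
      simp only [Finset.mem_filter, Finset.mem_product, Finset.mem_univ, Set.mem_toFinset,
        true_and]
      exact ⟨(coAct_mem_lbarAgree_iff hJ hmu₀ _).2 t.2, by
        rw [coAct_coAct, mul_inv_cancel_left]⟩
    · intro t _ t' _ h
      exact Subtype.ext (inv_injective (mul_right_cancel (Prod.ext_iff.1 h).1))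
    · rintro ⟨x, mu⟩ hp
      simp only [Finset.mem_filter, Finset.mem_product, Finset.mem_univ, Set.mem_toFinset,
        true_and] at hp
      have hmu : coAct (x₀ * x⁻¹) mu₀ = mu := by
        rw [← coAct_coAct, ← hp.2, coAct_coAct, mul_inv_cancel, coAct_one]
      refine ⟨⟨x₀ * x⁻¹, (coAct_mem_lbarAgree_iff hJ hmu₀ _).1 (hmu ▸ hp.1)⟩,
        Finset.mem_univ _, Prod.ext ?_ hmu⟩
      simp
  · rintro ⟨x, mu⟩ hp
    rw [Set.mem_toFinset, Xi_eq hJ]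
    exact ⟨x, mu, by simpa using hp, rfl⟩

/-- The subalgebra `lbar J lam` as a subspace of `J`. -/
def lbarSub (J : NonUnitalSubalgebra F R) (lam : ↥J →ₗ[F] F) : Submodule F ↥J :=
  (lbar J lam).toSubmodule.comap J.toSubmodule.subtype

theorem mem_lbarSub {lam : ↥J →ₗ[F] F} {X : ↥J} : X ∈ lbarSub J lam ↔ (X : R) ∈ lbar J lam :=
  Iff.rfl

/-- Translation by `lam` identifies the annihilator of `lbar J lam` with `lbarAgree J lam`. -/
def annEquiv (J : NonUnitalSubalgebra F R) (lam : ↥J →ₗ[F] F) :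
    ↥(lbarSub J lam).dualAnnihilator ≃ ↥(lbarAgree J lam) where
  toFun nu := ⟨lam + nu.1, fun X hX => by
    rw [LinearMap.add_apply, (Submodule.mem_dualAnnihilator _).1 nu.2 X hX, add_zero]⟩
  invFun mu := ⟨mu.1 - lam, (Submodule.mem_dualAnnihilator _).2 fun X hX => by
    rw [LinearMap.sub_apply, mu.2 X hX, sub_self]⟩
  left_inv nu := Subtype.ext (add_sub_cancel_left _ _)
  right_inv mu := Subtype.ext (add_sub_cancel _ _)

theorem card_lbarAgree (lam : ↥J →ₗ[F] F) :
    Nat.card ↥(lbar J lam) * Nat.card ↥(lbarAgree J lam) = Nat.card ↥J := by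
  have : Module.Finite F ↥J := Module.Finite.of_finite
  have hl : Nat.card ↥(lbar J lam) = Nat.card ↥(lbarSub J lam) :=
    Nat.card_congr
      { toFun := fun x => ⟨⟨x, lbar_le J lam x.2⟩, x.2⟩
        invFun := fun X => ⟨X.1, X.2⟩
        left_inv := fun _ => rfl
        right_inv := fun _ => rfl }
  rw [hl, ← Nat.card_congr (annEquiv J lam), Module.natCard_eq_pow_finrank (K := F),
    Module.natCard_eq_pow_finrank (K := F) (V := ↥(lbarSub J lam).dualAnnihilator),
    Module.natCard_eq_pow_finrank (K := F) (V := ↥J), ← pow_add,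
    Subspace.finrank_add_finrank_dualAnnihilator_eq]

/-- Fourier inversion: summing `θ ∘ mu` over `lbarAgree J lam` isolates `lbar J lam`. -/
theorem sum_lbarAgree {θ : AddChar F ℂ} (hθ : θ ≠ 1) (lam : ↥J →ₗ[F] F) (X : ↥J) :
    ∑ᶠ mu ∈ lbarAgree J lam, θ (mu X) =
      if (X : R) ∈ lbar J lam then (Nat.card ↥(lbarAgree J lam) : ℂ) * θ (lam X) else 0 := by
  have := Fintype.ofFinite (↥J →ₗ[F] F)
  have := Fintype.ofFinite ↥(lbarSub J lam).dualAnnihilator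
  rw [finsum_mem_eq_toFinset_sum]
  split_ifs with hX
  · rw [Finset.sum_congr rfl (g := fun _ => θ (lam X))
      (fun mu hmu => by rw [(Set.mem_toFinset.1 hmu) X hX]), Finset.sum_const, nsmul_eq_mul,
      Set.toFinset_card, Nat.card_eq_fintype_card]
  · let ψ : AddChar ↥(lbarSub J lam).dualAnnihilator ℂ :=
      { toFun := fun nu => θ (nu.1 X)
        map_zero_eq_one' := by simp
        map_add_eq_mul' := fun nu nu' => by
          rw [← AddChar.map_add_eq_mul]
          rfl }
    have hψ : ψ ≠ 1 := by
      obtain ⟨c, hc⟩ := AddChar.ne_one_iff.1 hθ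
      obtain ⟨f, hfX, hf⟩ := Submodule.exists_le_ker_of_notMem (mt (mem_lbarSub (lam := lam)).1 hX)
      refine AddChar.ne_one_iff.2 ⟨⟨(c / f X) • f, (Submodule.mem_dualAnnihilator _).2
        fun Y hY => ?_⟩, ?_⟩
      · rw [LinearMap.smul_apply, LinearMap.mem_ker.1 (hf hY), smul_zero]
      · change θ ((c / f X) • f X) ≠ 1
        rwa [smul_eq_mul, div_mul_cancel₀ _ hfX]
    calc ∑ mu ∈ (lbarAgree J lam).toFinset, θ (mu X)
        = ∑ mu : ↥(lbarAgree J lam), θ (mu.1 X) :=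
          Finset.sum_subtype _ (fun _ => Set.mem_toFinset) _
      _ = ∑ nu : ↥(lbarSub J lam).dualAnnihilator, θ (lam X) * ψ nu := by
          rw [← Equiv.sum_comp (annEquiv J lam)]
          exact Finset.sum_congr rfl fun nu _ => AddChar.map_add_eq_mul θ _ _
      _ = 0 := by rw [← Finset.mul_sum, AddChar.sum_eq_zero_of_ne_one hψ, mul_zero]

theorem mem_Lbarg_iff {lam : ↥J →ₗ[F] F} {x : ↥(algGroup F R J)} :
    x ∈ Lbarg J lam ↔ (gElt x : R) ∈ lbar J lam :=
  ⟨fun h => (Subgroup.mem_subgroupOf.1 h).1,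
    fun h => Subgroup.mem_subgroupOf.2 (mem_algGroup_of_sub_one_mem h)⟩

theorem statement9 (F : Type) [Field F] [Fintype F]
    (R : Type) [Ring R] [Algebra F R] [Fintype R]
    (J : NonUnitalSubalgebra F R) (hJ : IsNil J)
    (θ : AddChar F ℂ) (hθ : θ ≠ 1)
    (lam : ↥J →ₗ[F] F) :
    (∀ g : ↥(algGroup F R J),
      xi θ J lam g = ((Nat.card ↥(Sbarg J lam) : ℂ) / (Nat.card ↥(algGroup F R J) : ℂ)) *
        ∑ᶠ ν ∈ Xi J lam, thetaFn θ J ν g) ∧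
    (Nat.card ↥(Xi J lam) : ℂ) =
      (Nat.card ↥(algGroup F R J) : ℂ) ^ 2 /
        ((Nat.card ↥(Lbarg J lam) : ℂ) * (Nat.card ↥(Sbarg J lam) : ℂ)) := by
  have hT := card_lbarAgree lam
  rw [← hJ.card_algGroup (lbar_le J lam), ← hJ.card_algGroup le_rfl,
    ← card_algSubgroup (lbar_le J lam)] at hT
  change Nat.card ↥(Lbarg J lam) * _ = _ at hT
  have hTc : (Nat.card ↥(Lbarg J lam) : ℂ) * (Nat.card ↥(lbarAgree J lam) : ℂ) =
      (Nat.card ↥(algGroup F R J) : ℂ) := by exact_mod_cast hT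
  have hL : (Nat.card ↥(Lbarg J lam) : ℂ) ≠ 0 := Nat.cast_ne_zero.2 Nat.card_pos.ne'
  have hS : (Nat.card ↥(Sbarg J lam) : ℂ) ≠ 0 := Nat.cast_ne_zero.2 Nat.card_pos.ne'
  have hG : (Nat.card ↥(algGroup F R J) : ℂ) ≠ 0 := Nat.cast_ne_zero.2 Nat.card_pos.ne'
  have hT0 : (Nat.card ↥(lbarAgree J lam) : ℂ) ≠ 0 := right_ne_zero_of_mul (hTc ▸ hG)
  refine ⟨fun g => ?_, ?_⟩
  · have hterm : ∀ x : ↥(algGroup F R J),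
        ∑ᶠ mu ∈ lbarAgree J lam, thetaFn θ J (coAct x mu) g =
          (Nat.card ↥(lbarAgree J lam) : ℂ) *
            if x * g * x⁻¹ ∈ Lbarg J lam then thetaFn θ J lam (x * g * x⁻¹) else 0 := by
      intro x
      simp_rw [← thetaFn_conj, mem_Lbarg_iff, mul_ite, mul_zero]
      exact sum_lbarAgree hθ lam (gElt (x * g * x⁻¹))
    have hsum := sum_coAct_lbarAgree hJ lam (fun nu => thetaFn θ J nu g)
    simp_rw [hterm] at hsum
    rw [← mul_finsum] at hsum
    rw [xi, indFun]
    simp only [dite_eq_ite]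
    rw [div_mul_eq_mul_div, ← hsum, ← hTc]
    field_simp
  · have hsum := sum_coAct_lbarAgree hJ lam (fun _ => 1)
    have hone : ∀ A : Set (↥J →ₗ[F] F), ∑ᶠ mu ∈ A, (1 : ℂ) = (Nat.card ↥A : ℂ) := by
      intro A
      have := Fintype.ofFinite (↥J →ₗ[F] F)
      rw [finsum_mem_eq_toFinset_sum, Finset.sum_const, nsmul_one, Set.toFinset_card,
        Nat.card_eq_fintype_card]
    have := Fintype.ofFinite ↥(algGroup F R J)
    rw [hone, hone, finsum_eq_sum_of_fintype, Finset.sum_const, Finset.card_univ, nsmul_eq_mul,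
      ← Nat.card_eq_fintype_card] at hsum
    rw [eq_div_iff (mul_ne_zero hL hS), pow_two]
    linear_combination (-(Nat.card ↥(Lbarg J lam) : ℂ)) * hsum +
      (Nat.card ↥(algGroup F R J) : ℂ) * hTc

end IterChar
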